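/- In the complete data setting, the atomic norm over 𝒜 = {φ·a(f) : f ∈ [0,1), |φ|=1} satisfies the identity ‖y‖_𝒜 = min over u ∈ ℂ^M with T(u) ⪰ 0 and y ∈ range(T(u)) of [ (1/2) u₁ + (1/2) y^H T(u)⁺ y ]. -/

import Mathlib

open Matrix ComplexOrder Complex Real Classical
open scoped ENNReal

/-- The Hermitian Toeplitz matrix with first column `u`. -/
def toeplitz {M : ℕ} (u : Fin M → ℂ) : Matrix (Fin M) (Fin M) ℂ :=
  Matrix.of fun i j => if (j : ℕ) ≤ (i : ℕ) then u (i - j) else (starRingEnd ℂ) (u (j - i))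

/-- Moore–Penrose pseudoinverse, defined via the Penrose conditions. -/
noncomputable def pinv {n : Type*} [Fintype n] [DecidableEq n] (A : Matrix n n ℂ) :
    Matrix n n ℂ :=
  if h : ∃ B : Matrix n n ℂ,
      A * B * A = A ∧ B * A * B = B ∧ (A * B)ᴴ = A * B ∧ (B * A)ᴴ = B * A
  then h.choose else 0

/-- The atomic norm induced by a set of atoms (value `+∞` if no representation exists). -/
noncomputable def atomicNorm {n : Type*} [Fintype n] (𝒜 : Set (n → ℂ)) (y : n → ℂ) : ℝ≥0∞ :=
  sInf {t : ℝ≥0∞ | ∃ (k : ℕ) (c : Fin k → ℝ) (a : Fin k → (n → ℂ)),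
    (∀ i, 0 ≤ c i) ∧ (∀ i, a i ∈ 𝒜) ∧ y = ∑ i, (c i : ℂ) • a i ∧
    t = ∑ i, ENNReal.ofReal (c i)}

open scoped InnerProductSpace in
/-- Two finite families of vectors with the same Gram matrix are related by a linear isometry. -/
theorem exists_linearIsometry_apply_eq {ι V : Type*} [Fintype ι] [NormedAddCommGroup V]
    [InnerProductSpace ℂ V] [FiniteDimensional ℂ V] (p q : ι → V)
    (h : ∀ i j, ⟪p i, p j⟫_ℂ = ⟪q i, q j⟫_ℂ) :
    ∃ U : V →ₗᵢ[ℂ] V, ∀ i, U (p i) = q i := by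
  let P : (ι → ℂ) →ₗ[ℂ] V := Fintype.linearCombination ℂ p
  let Q : (ι → ℂ) →ₗ[ℂ] V := Fintype.linearCombination ℂ q
  have norm_eq : ∀ c, ‖Q c‖ = ‖P c‖ := fun c => by
    simp only [@norm_eq_sqrt_re_inner ℂ, P, Q, Fintype.linearCombination_apply, sum_inner,
      inner_sum, inner_smul_left, inner_smul_right, h]
  have ker_le : LinearMap.ker P ≤ LinearMap.ker Q := fun c hc => by
    rw [LinearMap.mem_ker] at hc ⊢
    rw [← norm_eq_zero, norm_eq, hc, norm_zero]
  let L : LinearMap.range P →ₗ[ℂ] V :=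
    (LinearMap.ker P).liftQ Q ker_le ∘ₗ P.quotKerEquivRange.symm.toLinearMap
  have L_apply : ∀ c, L ⟨P c, c, rfl⟩ = Q c := fun c => by
    have hc : P.quotKerEquivRange.symm ⟨P c, c, rfl⟩ = (LinearMap.ker P).mkQ c := by
      rw [LinearEquiv.symm_apply_eq]; rfl
    simp only [L, LinearMap.comp_apply, LinearEquiv.coe_coe, hc, Submodule.mkQ_apply,
      Submodule.liftQ_apply]
  let Li : LinearMap.range P →ₗᵢ[ℂ] V := ⟨L, by
    rintro ⟨_, c, rfl⟩
    rw [L_apply, norm_eq]; rfl⟩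
  refine ⟨Li.extend, fun i => ?_⟩
  have hP : P (Pi.single i 1) = p i := by simp [P]
  have hQ : Q (Pi.single i 1) = q i := by simp [Q]
  have hL := Li.extend_apply ⟨P (Pi.single i 1), _, rfl⟩
  rw [show Li _ = Q (Pi.single i 1) from L_apply _] at hL
  simpa only [hP, hQ] using hL

/-- Linear isometries of a finite-dimensional inner product space are semisimple. -/
theorem LinearIsometry.isSemisimple {V : Type*} [NormedAddCommGroup V]
    [InnerProductSpace ℂ V] [FiniteDimensional ℂ V] (U : V →ₗᵢ[ℂ] V) :
    Module.End.IsSemisimple (U.toLinearMap : Module.End ℂ V) := by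
  rw [Module.End.isSemisimple_iff]
  intro p hp
  refine ⟨pᗮ, ?_, p.isCompl_orthogonal⟩
  have hmap : p.map U.toLinearMap = p := by
    refine Submodule.eq_of_le_of_finrank_eq (Submodule.map_le_iff_le_comap.2 hp) ?_
    exact (Submodule.equivMapOfInjective U.toLinearMap U.injective p).finrank_eq.symm
  intro x hx y hy
  rw [← hmap] at hy
  obtain ⟨z, hz, rfl⟩ := hy
  simpa using hx z hz

open scoped InnerProductSpace in
/-- The moment sequence of a vector under an isometry of a finite-dimensional space is that of a
finite positive measure on the unit circle. -/
theorem LinearIsometry.exists_inner_pow_eq_sum {V : Type*} [NormedAddCommGroup V]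
    [InnerProductSpace ℂ V] [FiniteDimensional ℂ V] (U : V →ₗᵢ[ℂ] V) (v : V) :
    ∃ (s : Finset ℂ) (c : ℂ → ℝ), (∀ z, 0 ≤ c z) ∧ (∀ z ∈ s, ‖z‖ = 1) ∧
      ∀ i j : ℕ, ⟪(U.toLinearMap ^ i) v, (U.toLinearMap ^ j) v⟫_ℂ =
        ∑ z ∈ s, (c z : ℂ) * (star z ^ i * z ^ j) := by
  have hv : v ∈ ⨆ μ : ℂ, Module.End.eigenspace (U.toLinearMap : Module.End ℂ V) μ := by
    rw [U.isSemisimple.iSup_eigenspace_eq_top]; trivial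
  obtain ⟨g, hg, rfl⟩ := (Submodule.mem_iSup_iff_exists_finsupp _ _).1 hv
  have hU : ∀ z, U (g z) = z • g z := fun z => Module.End.mem_eigenspace_iff.1 (hg z)
  have hpow : ∀ (i : ℕ) z, (U.toLinearMap ^ i) (g z) = z ^ i • g z := fun i z => by
    induction i with
    | zero => simp
    | succ n ih =>
      rw [pow_succ', Module.End.mul_apply, ih, map_smul, LinearIsometry.coe_toLinearMap, hU,
        smul_smul, pow_succ]
  have hnorm : ∀ z ∈ g.support, ‖z‖ = 1 := fun z hz => by
    have h := U.norm_map (g z)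
    rw [hU, norm_smul] at h
    exact (mul_eq_right₀ (norm_ne_zero_iff.2 (Finsupp.mem_support_iff.1 hz))).1 h
  have horth : ∀ z ∈ g.support, ∀ w ∈ g.support, z ≠ w → ⟪g z, g w⟫_ℂ = 0 := by
    intro z hz w hw hzw
    have h := U.inner_map_map (g z) (g w)
    rw [hU, hU, inner_smul_left, inner_smul_right, ← mul_assoc] at h
    by_contra hne
    have h1 : (starRingEnd ℂ) z * w = 1 := (mul_eq_right₀ hne).1 h
    have h2 : z * (starRingEnd ℂ) z = 1 := by
      rw [Complex.mul_conj, Complex.normSq_eq_norm_sq, hnorm z hz]; simp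
    apply hzw
    calc z = z * ((starRingEnd ℂ) z * w) := by rw [h1, mul_one]
      _ = w := by rw [← mul_assoc, h2, one_mul]
  refine ⟨g.support, fun z => ‖g z‖ ^ 2, fun z => by positivity, hnorm, fun i j => ?_⟩
  simp only [Finsupp.sum, map_sum, hpow, sum_inner, inner_sum, inner_smul_left, inner_smul_right]
  refine Finset.sum_congr rfl fun z hz => ?_
  rw [Finset.sum_eq_single z]
  · rw [inner_self_eq_norm_sq_to_K]
    simp
    ring
  · intro w hw hne
    rw [horth w hw z hz hne]; simp
  · exact fun h => (h hz).elim

theorem toeplitz_castSucc_castSucc {N : ℕ} (u : Fin (N + 1) → ℂ) (i j : Fin N) :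
    toeplitz u i.castSucc j.castSucc = toeplitz u i.succ j.succ := by
  have hsub : ∀ a b : Fin N, (b : ℕ) ≤ a → a.castSucc - b.castSucc = a.succ - b.succ := by
    intro a b hab
    apply Fin.ext
    rw [Fin.sub_val_of_le (by simpa using hab), Fin.sub_val_of_le (by simpa using hab)]
    simp
  by_cases h : j ≤ i
  · simp [toeplitz, h, hsub i j h]
  · simp [toeplitz, h, hsub j i (le_of_not_ge h)]

open scoped InnerProductSpace in
/-- **Carathéodory–Toeplitz**: a positive semidefinite Toeplitz matrix is a nonnegative combination
of the rank-one matrices `a(f) a(f)ᴴ`. -/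
theorem exists_vandermonde_of_posSemidef {M : ℕ} (u : Fin M → ℂ)
    (hu : (toeplitz u).PosSemidef) :
    ∃ (k : ℕ) (c : Fin k → ℝ) (z : Fin k → ℂ), (∀ l, 0 ≤ c l) ∧ (∀ l, ‖z l‖ = 1) ∧
      ∀ i j : Fin M, toeplitz u i j =
        ∑ l, (c l : ℂ) * (z l ^ (i : ℕ) * star (z l ^ (j : ℕ))) := by
  cases M with
  | zero => exact ⟨0, 0, 0, by simp, by simp, fun i => i.elim0⟩
  | succ N =>
    obtain ⟨B, hB⟩ : ∃ B, toeplitz u = Bᴴ * B := by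
      open scoped MatrixOrder in
      exact CStarAlgebra.nonneg_iff_eq_star_mul_self.mp hu.nonneg
    let v : Fin (N + 1) → EuclideanSpace ℂ (Fin (N + 1)) := fun i => WithLp.toLp 2 (fun k => B k i)
    have hv : ∀ i j, ⟪v i, v j⟫_ℂ = toeplitz u i j := fun i j => by
      rw [hB, Matrix.mul_apply, PiLp.inner_apply]
      simp [v, mul_comm]
    obtain ⟨U, hU⟩ := exists_linearIsometry_apply_eq (fun i : Fin N => v i.castSucc)
      (fun i => v i.succ) (fun i j => by
        simp only [hv, toeplitz_castSucc_castSucc])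
    have hpow : ∀ i : Fin (N + 1), v i = (U.toLinearMap ^ (i : ℕ)) (v 0) := fun i => by
      induction i using Fin.induction with
      | zero => simp
      | succ i ih =>
        rw [← hU i, ih, Fin.val_succ, pow_succ', Module.End.mul_apply]; rfl
    obtain ⟨s, c, hc, hs, hsum⟩ := U.exists_inner_pow_eq_sum (v 0)
    refine ⟨s.card, fun l => c (s.equivFin.symm l), fun l => star (s.equivFin.symm l : ℂ),
      fun l => hc _, fun l => ?_, fun i j => ?_⟩
    · rw [norm_star]; exact hs _ (s.equivFin.symm l).2
    · rw [← hv, hpow i, hpow j, hsum, ← Finset.sum_coe_sort s,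
        ← s.equivFin.symm.sum_comp]
      simp

theorem Matrix.IsHermitian.exists_penrose {n : Type*} [Fintype n] [DecidableEq n]
    {A : Matrix n n ℂ} (hA : A.IsHermitian) :
    ∃ B : Matrix n n ℂ,
      A * B * A = A ∧ B * A * B = B ∧ (A * B)ᴴ = A * B ∧ (B * A)ᴴ = B * A := by
  let φ := Unitary.conjStarAlgAut ℂ (Matrix n n ℂ) hA.eigenvectorUnitary
  let d : n → ℂ := fun i => hA.eigenvalues i
  have hφ : A = φ (diagonal d) := hA.spectral_theorem
  refine ⟨φ (diagonal fun i => (d i)⁻¹), ?_⟩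
  have hstar : ∀ X, (φ X)ᴴ = φ Xᴴ := fun X => (map_star φ X).symm
  have hd : ∀ i, star (d i) = d i := fun i => by simp [d]
  have hmul : ∀ i, d i * (d i)⁻¹ * d i = d i := fun i => mul_inv_mul_cancel _
  have hmul' : ∀ i, (d i)⁻¹ * d i * (d i)⁻¹ = (d i)⁻¹ := fun i => by
    simpa using mul_inv_mul_cancel (d i)⁻¹
  refine ⟨?_, ?_, ?_, ?_⟩ <;> rw [hφ] <;>
    simp only [← map_mul, hstar, diagonal_mul_diagonal, diagonal_conjTranspose, hmul, hmul'] <;>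
    congr 2 <;> ext i <;> simp only [Pi.star_apply, star_mul, star_inv₀, hd] <;> ring

/-- The quadratic form of the pseudoinverse at a vector `A w` of the range. -/
theorem star_dotProduct_pinv_mulVec {n : Type*} [Fintype n] [DecidableEq n]
    {A : Matrix n n ℂ} (hA : A.IsHermitian) (w : n → ℂ) :
    star (A *ᵥ w) ⬝ᵥ (pinv A *ᵥ (A *ᵥ w)) = star w ⬝ᵥ (A *ᵥ w) := by
  have h := hA.exists_penrose
  have hp : A * pinv A * A = A := by
    rw [pinv, dif_pos h]; exact h.choose_spec.1
  rw [star_mulVec, hA.eq, ← dotProduct_mulVec, mulVec_mulVec, mulVec_mulVec, hp]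

/-- The matrix `∑ cₗ a(zₗ) a(zₗ)ᴴ` applied to a vector. -/
theorem mulVec_eq_sum_of_vandermonde {M k : ℕ} {T : Matrix (Fin M) (Fin M) ℂ} {c : Fin k → ℝ}
    {a : Fin k → Fin M → ℂ} (hT : ∀ i j, T i j = ∑ l, (c l : ℂ) * (a l i * star (a l j)))
    (w : Fin M → ℂ) :
    T *ᵥ w = ∑ l, ((c l : ℂ) * (star (a l) ⬝ᵥ w)) • a l := by
  ext i
  simp only [mulVec, dotProduct, hT, Finset.sum_mul, Finset.sum_apply, Pi.smul_apply, smul_eq_mul,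
    Finset.mul_sum, Pi.star_apply]
  rw [Finset.sum_comm]
  exact Finset.sum_congr rfl fun l _ => Finset.sum_congr rfl fun j _ => by ring

theorem star_dotProduct_mulVec_of_vandermonde {M k : ℕ} {T : Matrix (Fin M) (Fin M) ℂ}
    {c : Fin k → ℝ} {a : Fin k → Fin M → ℂ}
    (hT : ∀ i j, T i j = ∑ l, (c l : ℂ) * (a l i * star (a l j))) (w : Fin M → ℂ) :
    star w ⬝ᵥ (T *ᵥ w) = ((∑ l, c l * ‖star (a l) ⬝ᵥ w‖ ^ 2 : ℝ) : ℂ) := by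
  rw [mulVec_eq_sum_of_vandermonde hT, dotProduct_sum]
  push_cast
  refine Finset.sum_congr rfl fun l _ => ?_
  rw [dotProduct_smul, smul_eq_mul, mul_assoc, ← Complex.mul_conj']
  congr 2
  rw [← Complex.star_def, star_dotProduct]

/-- A positive weighted sum of rank-one matrices has all its generators in its range. -/
theorem exists_mulVec_eq_of_vandermonde {M k : ℕ} {T : Matrix (Fin M) (Fin M) ℂ} {c : Fin k → ℝ}
    (hc : ∀ l, 0 ≤ c l) {a : Fin k → Fin M → ℂ}
    (hT : ∀ i j, T i j = ∑ l, (c l : ℂ) * (a l i * star (a l j))) (φ : Fin k → ℂ) :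
    ∃ w, T *ᵥ w = ∑ l, (c l : ℂ) • φ l • a l := by
  let A : Matrix (Fin M) (Fin k) ℂ := Matrix.of fun i l => (√(c l) : ℂ) * a l i
  have hsq : ∀ l, (√(c l) : ℂ) * √(c l) = c l := fun l => by
    rw [← Complex.ofReal_mul, Real.mul_self_sqrt (hc l)]
  have hTA : T = A * Aᴴ := by
    ext i j
    rw [hT, Matrix.mul_apply]
    refine Finset.sum_congr rfl fun l _ => ?_
    simp only [A, conjTranspose_apply, Matrix.of_apply, star_mul', Complex.star_def,
      Complex.conj_ofReal]
    rw [← hsq]; ring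
  have hrange : LinearMap.range (A * Aᴴ).mulVecLin = LinearMap.range A.mulVecLin := by
    refine Submodule.eq_of_le_of_finrank_eq ?_ (Matrix.rank_self_mul_conjTranspose A)
    rw [Matrix.mulVecLin_mul]
    exact LinearMap.range_comp_le_range _ _
  have hmem : A *ᵥ (fun l => (√(c l) : ℂ) * φ l) ∈ LinearMap.range (A * Aᴴ).mulVecLin := by
    rw [hrange]; exact ⟨_, rfl⟩
  obtain ⟨w, hw⟩ := hmem
  refine ⟨w, ?_⟩
  rw [hTA, ← Matrix.mulVecLin_apply, hw]
  ext i
  simp only [mulVec, dotProduct, A, Matrix.of_apply, Finset.sum_apply, Pi.smul_apply, smul_eq_mul]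
  refine Finset.sum_congr rfl fun l _ => ?_
  rw [← hsq]; ring

/-- Unimodular `z` gives a Toeplitz matrix `∑ cₗ a(zₗ) a(zₗ)ᴴ`. -/
theorem toeplitz_sum_pow {M k : ℕ} (c : Fin k → ℝ) (z : Fin k → ℂ) (hz : ∀ l, ‖z l‖ = 1)
    (i j : Fin M) :
    toeplitz (fun m : Fin M => ∑ l, (c l : ℂ) * z l ^ (m : ℕ)) i j =
      ∑ l, (c l : ℂ) * (z l ^ (i : ℕ) * star (z l ^ (j : ℕ))) := by
  have key : ∀ l (a b : ℕ), b ≤ a → z l ^ (a - b) = z l ^ a * star (z l ^ b) := by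
    intro l a b hab
    have h1 : z l ^ b * star (z l ^ b) = 1 := by
      rw [Complex.star_def, Complex.mul_conj', norm_pow, hz]; simp
    calc z l ^ (a - b) = z l ^ (a - b) * (z l ^ b * star (z l ^ b)) := by rw [h1, mul_one]
      _ = z l ^ a * star (z l ^ b) := by rw [← mul_assoc, ← pow_add, Nat.sub_add_cancel hab]
  by_cases h : (j : ℕ) ≤ i
  · simp only [toeplitz, Matrix.of_apply, if_pos h]
    rw [Fin.sub_val_of_le h]
    simp only [key _ _ _ h]
  · have h' : (i : ℕ) ≤ j := by omega
    simp only [toeplitz, Matrix.of_apply, if_neg h]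
    rw [Fin.sub_val_of_le h', map_sum]
    refine Finset.sum_congr rfl fun l _ => ?_
    rw [key _ _ _ h', map_mul, Complex.conj_ofReal, map_mul, Complex.star_def, Complex.conj_conj]
    ring

theorem posSemidef_of_vandermonde {M k : ℕ} {T : Matrix (Fin M) (Fin M) ℂ} {c : Fin k → ℝ}
    (hc : ∀ l, 0 ≤ c l) {a : Fin k → Fin M → ℂ}
    (hT : ∀ i j, T i j = ∑ l, (c l : ℂ) * (a l i * star (a l j))) : T.PosSemidef := by
  refine .of_dotProduct_mulVec_nonneg ?_ fun w => ?_
  · ext i j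
    simp only [conjTranspose_apply, hT, star_sum, star_mul', Complex.star_def,
      Complex.conj_ofReal, Complex.conj_conj]
    exact Finset.sum_congr rfl fun l _ => by ring
  · rw [star_dotProduct_mulVec_of_vandermonde hT, Complex.zero_le_real]
    exact Finset.sum_nonneg fun l _ => mul_nonneg (hc l) (by positivity)

theorem exists_mem_Ico_exp_eq {z : ℂ} (hz : ‖z‖ = 1) :
    ∃ f ∈ Set.Ico (0 : ℝ) 1, Complex.exp (2 * π * I * f) = z := by
  refine ⟨Int.fract (z.arg / (2 * π)), ⟨Int.fract_nonneg _, Int.fract_lt_one _⟩, ?_⟩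
  have h := Complex.norm_mul_exp_arg_mul_I z
  rw [hz, Complex.ofReal_one, one_mul] at h
  conv_rhs => rw [← h]
  rw [Complex.exp_eq_exp_iff_exists_int]
  refine ⟨-⌊z.arg / (2 * π)⌋, ?_⟩
  rw [Int.fract]
  have : (π : ℂ) ≠ 0 := Complex.ofReal_ne_zero.2 Real.pi_ne_zero
  push_cast
  field_simp
  ring

/-- The sinusoidal atoms are the vectors `φ (1, z, …, z^(M-1))` with `φ`, `z` unimodular. -/
theorem sinusoid_atoms_eq (M : ℕ) :
    {a : Fin M → ℂ | ∃ f ∈ Set.Ico (0 : ℝ) 1, ∃ φ : ℂ, ‖φ‖ = 1 ∧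
        a = fun m : Fin M => φ * Complex.exp (2 * π * I * ((m : ℕ) : ℂ) * (f : ℂ))} =
      {a | ∃ z φ : ℂ, ‖z‖ = 1 ∧ ‖φ‖ = 1 ∧ a = φ • fun m : Fin M => z ^ (m : ℕ)} := by
  have hexp : ∀ (f : ℝ) (m : ℕ), Complex.exp (2 * π * I * (m : ℂ) * (f : ℂ)) =
      Complex.exp (2 * π * I * f) ^ m := fun f m => by
    rw [← Complex.exp_nat_mul]; congr 1; ring
  ext a
  constructor
  · rintro ⟨f, -, φ, hφ, rfl⟩
    refine ⟨Complex.exp (2 * π * I * f), φ, ?_, hφ, ?_⟩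
    · rw [show (2 * π * I * f : ℂ) = ((2 * π * f : ℝ) : ℂ) * I by push_cast; ring,
        Complex.norm_exp_ofReal_mul_I]
    · ext m; simp [hexp]
  · rintro ⟨z, φ, hz, hφ, rfl⟩
    obtain ⟨f, hf, rfl⟩ := exists_mem_Ico_exp_eq hz
    exact ⟨f, hf, φ, hφ, by ext m; simp [hexp]⟩

theorem atomicNorm_le_of_sum {M k : ℕ} (z b : Fin k → ℂ) (hz : ∀ l, ‖z l‖ = 1) :
    atomicNorm {a : Fin M → ℂ | ∃ z φ : ℂ, ‖z‖ = 1 ∧ ‖φ‖ = 1 ∧ a = φ • fun m : Fin M => z ^ (m : ℕ)}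
      (∑ l, b l • fun m : Fin M => z l ^ (m : ℕ)) ≤ ENNReal.ofReal (∑ l, ‖b l‖) := by
  refine sInf_le ⟨k, fun l => ‖b l‖,
    fun l => Complex.exp ((b l).arg * I) • fun m : Fin M => z l ^ (m : ℕ),
    fun l => norm_nonneg _, fun l => ⟨z l, _, hz l, Complex.norm_exp_ofReal_mul_I _, rfl⟩, ?_,
    ENNReal.ofReal_sum_of_nonneg fun l _ => norm_nonneg _⟩
  simp only [smul_smul, Complex.norm_mul_exp_arg_mul_I]

/-- Complete-data SDP characterization of the atomic norm of sinusoids: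
`‖y‖_𝒜 = min { ½u₁ + ½ yᴴ T(u)⁺ y : T(u) ⪰ 0, y ∈ range T(u) }`. -/
theorem atomicNorm_eq_min_toeplitz {M : ℕ} (hM : 0 < M) (y : Fin M → ℂ) :
    atomicNorm {a : Fin M → ℂ | ∃ f ∈ Set.Ico (0 : ℝ) 1, ∃ φ : ℂ, ‖φ‖ = 1 ∧
        a = fun m : Fin M => φ * Complex.exp (2 * π * I * ((m : ℕ) : ℂ) * (f : ℂ))} y
      = sInf {t : ℝ≥0∞ | ∃ u : Fin M → ℂ, (toeplitz u).PosSemidef ∧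
          (∃ w, (toeplitz u).mulVec w = y) ∧
          t = ENNReal.ofReal ((u ⟨0, hM⟩).re / 2 +
            (star y ⬝ᵥ (pinv (toeplitz u)).mulVec y).re / 2)} := by
  rw [sinusoid_atoms_eq]
  apply le_antisymm
  · refine le_sInf ?_
    rintro _ ⟨u, hu, ⟨w, rfl⟩, rfl⟩
    obtain ⟨k, c, z, hc, hz, hT⟩ := exists_vandermonde_of_posSemidef u hu
    have hu0 : (u ⟨0, hM⟩).re = ∑ l, c l := by
      have h := hT ⟨0, hM⟩ ⟨0, hM⟩
      have h0 : (⟨0, hM⟩ - ⟨0, hM⟩ : Fin M) = ⟨0, hM⟩ := by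
        apply Fin.ext
        rw [Fin.sub_val_of_le le_rfl]
        simp
      simp only [toeplitz, Matrix.of_apply, le_refl, if_true, h0] at h
      rw [h]
      simp
    rw [star_dotProduct_pinv_mulVec hu.isHermitian, star_dotProduct_mulVec_of_vandermonde hT,
      Complex.ofReal_re, hu0, mulVec_eq_sum_of_vandermonde hT]
    refine (atomicNorm_le_of_sum z _ hz).trans (ENNReal.ofReal_le_ofReal ?_)
    rw [Finset.sum_div, Finset.sum_div, ← Finset.sum_add_distrib]
    refine Finset.sum_le_sum fun l _ => ?_
    rw [norm_mul, Complex.norm_of_nonneg (hc l)]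
    nlinarith [mul_nonneg (hc l)
      (sq_nonneg (‖star (fun i : Fin M => z l ^ (i : ℕ)) ⬝ᵥ w‖ - 1))]
  · refine le_sInf ?_
    rintro _ ⟨k, c, a, hc, ha, rfl, rfl⟩
    choose z φ hz hφ ha using ha
    obtain rfl : a = fun l => φ l • fun m : Fin M => z l ^ (m : ℕ) := funext ha
    let u : Fin M → ℂ := fun m => ∑ l, (c l : ℂ) * z l ^ (m : ℕ)
    have hT := toeplitz_sum_pow (M := M) c z hz
    have hpsd : (toeplitz u).PosSemidef := posSemidef_of_vandermonde hc hT
    obtain ⟨w, hw⟩ := exists_mulVec_eq_of_vandermonde hc hT φ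
    refine le_trans (sInf_le ⟨u, hpsd, ⟨w, hw⟩, rfl⟩) ?_
    rw [← ENNReal.ofReal_sum_of_nonneg fun l _ => hc l, ← hw]
    apply ENNReal.ofReal_le_ofReal
    rw [star_dotProduct_pinv_mulVec hpsd.isHermitian]
    have hu0 : (u ⟨0, hM⟩).re = ∑ l, c l := by simp [u]
    have hq := star_dotProduct_mulVec_of_vandermonde hT w
    have hq' : (star w ⬝ᵥ (toeplitz u *ᵥ w)).re ≤
        ∑ l, c l * ‖star (fun m : Fin M => z l ^ (m : ℕ)) ⬝ᵥ w‖ := by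
      rw [hw, dotProduct_sum, Complex.re_sum]
      refine Finset.sum_le_sum fun l _ => (Complex.re_le_norm _).trans_eq ?_
      rw [dotProduct_smul, dotProduct_smul, norm_smul, norm_smul, hφ, one_mul,
        Complex.norm_of_nonneg (hc l), star_dotProduct, norm_star]
    have hre : (star w ⬝ᵥ (toeplitz u *ᵥ w)).re = _ := congrArg Complex.re hq
    rw [Complex.ofReal_re] at hre
    have hle : ∑ l, c l * ‖star (fun m : Fin M => z l ^ (m : ℕ)) ⬝ᵥ w‖ ≤
        (∑ l, c l + ∑ l, c l * ‖star (fun m : Fin M => z l ^ (m : ℕ)) ⬝ᵥ w‖ ^ 2) / 2 := by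
      rw [← Finset.sum_add_distrib, Finset.sum_div]
      refine Finset.sum_le_sum fun l _ => ?_
      nlinarith [mul_nonneg (hc l)
        (sq_nonneg (‖star (fun m : Fin M => z l ^ (m : ℕ)) ⬝ᵥ w‖ - 1))]
    linarith
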